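/- Every irreducible 𝔤-submodule M of V = 𝔤 ⊕ 𝔤* (for the adjoint–coadjoint action) on which the 𝔤-action is nontrivial is contained in 𝔤ᵢ ⊕ 𝔤ᵢ* for exactly one index i. -/

import Mathlib

namespace QPar

variable (k g : Type*) [Field k] [LieRing g] [LieAlgebra k g]

/-- The canonical symplectic form ω on V = 𝔤 ⊕ 𝔤*:
`ω((ξ,φ),(ξ',φ')) = φ(ξ') − φ'(ξ)`. -/
def omegaV (u v : g × Module.Dual k g) : k := u.2 v.1 - v.2 u.1

/-- The adjoint–coadjoint action of 𝔤 on V = 𝔤 ⊕ 𝔤*: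
`η·(ξ,φ) = (⁅η,ξ⁆, −φ∘ad(η))`. -/
def adCoad (η : g) (v : g × Module.Dual k g) : g × Module.Dual k g :=
  (⁅η, v.1⁆, - (v.2 ∘ₗ (LieAlgebra.ad k g η : g →ₗ[k] g)))

/-- A subspace of V is invariant if it is stable under the adjoint–coadjoint action. -/
def IsInvariant (L : Submodule k (g × Module.Dual k g)) : Prop :=
  ∀ η : g, ∀ v ∈ L, adCoad k g η v ∈ L

/-- A subspace of V is Lagrangian if it equals its ω-orthogonal complement. -/
def IsLagrangian (L : Submodule k (g × Module.Dual k g)) : Prop :=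
  ∀ v : g × Module.Dual k g, v ∈ L ↔ ∀ w ∈ L, omegaV k g v w = 0

/-- `L` is a Lagrangian subspace of the subspace `W` of V, for the restriction of ω:
`L ⊆ W` and `L` equals its ω-orthogonal complement taken inside `W`. -/
def IsLagrangianIn (W L : Submodule k (g × Module.Dual k g)) : Prop :=
  L ≤ W ∧ ∀ v ∈ W, (v ∈ L ↔ ∀ w ∈ L, omegaV k g v w = 0)

/-- The center of 𝔤, as a subspace. -/
def centerS : Submodule k g := (LieAlgebra.center k g).toSubmodule

/-- `I` is a simple ideal of 𝔤: an ideal which is nonabelian and has no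
nontrivial proper ideals. -/
def IsSimpleIdeal (I : Submodule k g) : Prop :=
  (∀ η : g, ∀ x ∈ I, ⁅η, x⁆ ∈ I) ∧
  (∃ x ∈ I, ∃ y ∈ I, ⁅x, y⁆ ≠ 0) ∧
  ∀ J : Submodule k g, J ≤ I → (∀ x ∈ I, ∀ y ∈ J, ⁅x, y⁆ ∈ J) → J = ⊥ ∨ J = I

/-- 𝔷*, realized as the subspace of 𝔤* of functionals vanishing on all the 𝔤ᵢ. -/
def zDual {n : ℕ} (gi : Fin n → Submodule k g) : Submodule k (Module.Dual k g) :=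
  (⨆ i, gi i).dualAnnihilator

/-- 𝔤ᵢ*, realized as the subspace of 𝔤* of functionals vanishing on all the other
summands, i.e. on 𝔷 and on the 𝔤ⱼ for j ≠ i. -/
def giDual {n : ℕ} (gi : Fin n → Submodule k g) (i : Fin n) :
    Submodule k (Module.Dual k g) :=
  (centerS k g ⊔ ⨆ j, ⨆ _ : j ≠ i, gi j).dualAnnihilator

/-- The subspace 𝔷 ⊕ 𝔷* of V. -/
def zPart {n : ℕ} (gi : Fin n → Submodule k g) : Submodule k (g × Module.Dual k g) :=
  (centerS k g).prod (zDual k g gi)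

/-- The subspace 𝔤ᵢ ⊕ 𝔤ᵢ* of V. -/
def giPart {n : ℕ} (gi : Fin n → Submodule k g) (i : Fin n) :
    Submodule k (g × Module.Dual k g) :=
  (gi i).prod (giDual k g gi i)

end QPar

namespace QPar

section Action

variable {k g : Type*} [Field k] [LieRing g] [LieAlgebra k g]

lemma adCoad_add (η : g) (u v : g × Module.Dual k g) :
    adCoad k g η (u + v) = adCoad k g η u + adCoad k g η v := by
  ext <;> simp [adCoad, add_comm]

lemma adCoad_smul (η : g) (c : k) (v : g × Module.Dual k g) :
    adCoad k g η (c • v) = c • adCoad k g η v := by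
  ext <;> simp [adCoad]

lemma adCoad_zero (η : g) : adCoad k g η 0 = 0 := by
  ext <;> simp [adCoad]

lemma add_adCoad (η ζ : g) (v : g × Module.Dual k g) :
    adCoad k g (η + ζ) v = adCoad k g η v + adCoad k g ζ v := by
  ext <;> simp [adCoad, add_comm]

lemma smul_adCoad (c : k) (η : g) (v : g × Module.Dual k g) :
    adCoad k g (c • η) v = c • adCoad k g η v := by
  ext <;> simp [adCoad]

lemma zero_adCoad (v : g × Module.Dual k g) : adCoad k g 0 v = 0 := by
  ext <;> simp [adCoad]

lemma adCoad_adCoad (ζ η : g) (v : g × Module.Dual k g) :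
    adCoad k g ζ (adCoad k g η v) =
      adCoad k g ⁅ζ, η⁆ v + adCoad k g η (adCoad k g ζ v) := by
  ext <;> simp [adCoad]

lemma adCoad_eq_zero_of_mem_centerS {η : g} (hη : η ∈ centerS k g)
    (v : g × Module.Dual k g) : adCoad k g η v = 0 := by
  have h (x : g) : ⁅η, x⁆ = 0 := by
    rw [← lie_skew, (LieModule.mem_maxTrivSubmodule k g g η).1 hη x, neg_zero]
  ext <;> simp [adCoad, h]

variable (k) in
/-- The subspace of elements of 𝔤 acting as zero on `M`. -/
def actionKernel (M : Submodule k (g × Module.Dual k g)) : Submodule k g where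
  carrier := {η | ∀ m ∈ M, adCoad k g η m = 0}
  add_mem' ha hb m hm := by rw [add_adCoad, ha m hm, hb m hm, add_zero]
  zero_mem' m _ := zero_adCoad m
  smul_mem' c a ha m hm := by rw [smul_adCoad, ha m hm, smul_zero]

/-- The span `I · M` of all `η · m` with `η ∈ I` and `m ∈ M`. -/
def actionSpan (I : Submodule k g) (M : Submodule k (g × Module.Dual k g)) :
    Submodule k (g × Module.Dual k g) :=
  Submodule.span k {v | ∃ η ∈ I, ∃ m ∈ M, adCoad k g η m = v}

lemma actionSpan_le {I : Submodule k g} {M W : Submodule k (g × Module.Dual k g)} :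
    actionSpan I M ≤ W ↔ ∀ η ∈ I, ∀ m ∈ M, adCoad k g η m ∈ W := by
  refine Submodule.span_le.trans ⟨fun h η hη m hm => h ⟨η, hη, m, hm, rfl⟩, ?_⟩
  rintro h _ ⟨η, hη, m, hm, rfl⟩
  exact h η hη m hm

lemma isInvariant_actionSpan {I : Submodule k g} {M : Submodule k (g × Module.Dual k g)}
    (hI : ∀ η : g, ∀ x ∈ I, ⁅η, x⁆ ∈ I) (hM : IsInvariant k g M) :
    IsInvariant k g (actionSpan I M) := by
  intro ζ v hv
  have hgen : ∀ η ∈ I, ∀ m ∈ M, adCoad k g η m ∈ actionSpan I M := actionSpan_le.1 le_rfl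
  induction hv using Submodule.span_induction with
  | mem v hv =>
    obtain ⟨η, hη, m, hm, rfl⟩ := hv
    rw [adCoad_adCoad]
    exact add_mem (hgen _ (hI ζ η hη) m hm) (hgen η hη _ (hM ζ m hm))
  | zero => rw [adCoad_zero]; exact zero_mem _
  | add u v _ _ hu hv => rw [adCoad_add]; exact add_mem hu hv
  | smul c v _ hv => rw [adCoad_smul]; exact Submodule.smul_mem _ c hv

lemma actionSpan_eq_of_not_le_actionKernel {I : Submodule k g}
    {M : Submodule k (g × Module.Dual k g)} (hI : ∀ η : g, ∀ x ∈ I, ⁅η, x⁆ ∈ I)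
    (hM : IsInvariant k g M)
    (hirr : ∀ N : Submodule k (g × Module.Dual k g),
      N ≤ M → IsInvariant k g N → N = ⊥ ∨ N = M)
    (hIM : ¬ I ≤ actionKernel k M) : actionSpan I M = M := by
  refine (hirr _ (actionSpan_le.2 fun η _ m hm => hM η m hm)
    (isInvariant_actionSpan hI hM)).resolve_left fun h => hIM fun η hη m hm => ?_
  exact (Submodule.mem_bot k).1 (actionSpan_le.1 h.le η hη m hm)

end Action

section Decomposition

variable {k g : Type*} [Field k] [LieRing g] [LieAlgebra k g] {n : ℕ}
  {gi : Fin n → Submodule k g}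

lemma adCoad_mem_giPart (hI : ∀ i, ∀ η : g, ∀ x ∈ gi i, ⁅η, x⁆ ∈ gi i)
    (hdisj : Pairwise fun i j => Disjoint (gi i) (gi j)) {i : Fin n} {η : g} (hη : η ∈ gi i)
    (v : g × Module.Dual k g) : adCoad k g η v ∈ giPart k g gi i := by
  have hleft (x : g) : ⁅η, x⁆ ∈ gi i := by
    rw [← lie_skew]
    exact neg_mem (hI i x η hη)
  refine ⟨hleft v.1, ?_⟩
  have hker : centerS k g ⊔ ⨆ j, ⨆ _ : j ≠ i, gi j ≤
      LinearMap.ker (LieAlgebra.ad k g η : g →ₗ[k] g) := by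
    refine sup_le (fun z hz => ?_) (iSup₂_le fun j hj x hx => ?_)
    · exact (LieModule.mem_maxTrivSubmodule k g g z).1 hz η
    · exact Submodule.disjoint_def.1 (hdisj hj.symm) _ (hleft x) (hI j η x hx)
  refine (Submodule.mem_dualAnnihilator _).2 fun x hx => ?_
  have hx0 : ⁅η, x⁆ = 0 := hker hx
  simp [adCoad, hx0]

lemma disjoint_giPart (hdisj : Pairwise fun i j => Disjoint (gi i) (gi j))
    (htop : centerS k g ⊔ ⨆ i, gi i = ⊤) {i j : Fin n} (hij : i ≠ j) :
    Disjoint (giPart k g gi i) (giPart k g gi j) := by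
  refine Submodule.disjoint_def.2 fun v hi hj => Prod.ext ?_ ?_
  · exact Submodule.disjoint_def.1 (hdisj hij) _ hi.1 hj.1
  · have hcover : centerS k g ⊔ ⨆ l, gi l ≤
        (centerS k g ⊔ ⨆ l, ⨆ _ : l ≠ i, gi l) ⊔ (centerS k g ⊔ ⨆ l, ⨆ _ : l ≠ j, gi l) := by
      refine sup_le (le_sup_left.trans le_sup_left) (iSup_le fun l => ?_)
      by_cases hl : l = i
      · exact (le_iSup₂ (f := fun l (_ : l ≠ j) => gi l) l (hl ▸ hij)).trans
          (le_sup_right.trans le_sup_right)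
      · exact (le_iSup₂ (f := fun l (_ : l ≠ i) => gi l) l hl).trans
          (le_sup_right.trans le_sup_left)
    have hv : v.2 ∈ giDual k g gi i ⊓ giDual k g gi j := ⟨hi.2, hj.2⟩
    rw [giDual, giDual, ← Submodule.dualAnnihilator_sup_eq,
      top_le_iff.1 (htop.ge.trans hcover), Submodule.dualAnnihilator_top] at hv
    exact (Submodule.mem_bot k).1 hv

end Decomposition

end QPar

/-- Every irreducible 𝔤-submodule `M` of `V = 𝔤 ⊕ 𝔤*` (for the
adjoint–coadjoint action) on which the 𝔤-action is nontrivial is contained in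
`𝔤ᵢ ⊕ 𝔤ᵢ*` for exactly one index `i`. -/
theorem statement13
    (k g : Type*) [Field k] [CharZero k] [IsAlgClosed k]
    [LieRing g] [LieAlgebra k g] [FiniteDimensional k g]
    (n : ℕ) (gi : Fin n → Submodule k g)
    (hsimple : ∀ i, QPar.IsSimpleIdeal k g (gi i))
    (hdec : DirectSum.IsInternal (fun o : Option (Fin n) => o.elim (QPar.centerS k g) gi))
    (M : Submodule k (g × Module.Dual k g))
    (hMinv : QPar.IsInvariant k g M)
    (hMne : M ≠ ⊥)
    (hirr : ∀ N : Submodule k (g × Module.Dual k g),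
      N ≤ M → QPar.IsInvariant k g N → N = ⊥ ∨ N = M)
    (hnontriv : ∃ η : g, ∃ m ∈ M, QPar.adCoad k g η m ≠ 0) :
    ∃! i : Fin n, M ≤ QPar.giPart k g gi i := by
  have hI i := (hsimple i).1
  have hdisj : Pairwise fun i j => Disjoint (gi i) (gi j) := fun i j hij =>
    hdec.submodule_iSupIndep.pairwiseDisjoint ((Option.some_injective _).ne hij)
  have htop : QPar.centerS k g ⊔ ⨆ i, gi i = ⊤ := by
    rw [← hdec.submodule_iSup_eq_top, iSup_option]
    rfl
  obtain ⟨i, hi⟩ : ∃ i, ¬ gi i ≤ QPar.actionKernel k M := by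
    by_contra! hker
    obtain ⟨η, m, hm, hne⟩ := hnontriv
    have hle : QPar.centerS k g ⊔ ⨆ i, gi i ≤ QPar.actionKernel k M :=
      sup_le (fun z hz m _ => QPar.adCoad_eq_zero_of_mem_centerS hz m) (iSup_le hker)
    exact hne ((htop.ge.trans hle) (Submodule.mem_top : η ∈ ⊤) m hm)
  have hMi : M ≤ QPar.giPart k g gi i := by
    rw [← QPar.actionSpan_eq_of_not_le_actionKernel (hI i) hMinv hirr hi]
    exact QPar.actionSpan_le.2 fun η hη m _ => QPar.adCoad_mem_giPart hI hdisj hη m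
  refine ⟨i, hMi, fun j hMj => ?_⟩
  by_contra hji
  exact hMne (le_bot_iff.1 (QPar.disjoint_giPart hdisj htop hji hMj hMi))
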